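/- Let p ≥ 3, h = 0 and β > β*(p), let m_* be the unique positive global maximizer of H_{β,0,p}, and let β̂ be the maximum pseudolikelihood estimate of β given X ~ P_{β,0,p}. Then as N → ∞, √N(β̂ − β) converges in distribution to a centered Gaussian with variance −H''_{β,0,p}(m_*)/(p² m_*^{2p−2}). -/

import Mathlib

open Real MeasureTheory Filter
open scoped BigOperators Topology

noncomputable section

/-- The spin value (`±1`) of a Boolean coordinate. -/
def spin (b : Bool) : ℝ := if b then 1 else -1

/-- The total magnetization `S_N = ∑ᵢ Xᵢ` of a configuration. -/
def mag {N : ℕ} (x : Fin N → Bool) : ℝ := ∑ i, spin (x i)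

/-- The Hamiltonian of the `p`-spin Curie-Weiss model:
`β N^{1-p} ∑_{i₁,…,i_p} x_{i₁} ⋯ x_{i_p} + h ∑ᵢ xᵢ`. -/
def cwHamiltonian (p N : ℕ) (β h : ℝ) (x : Fin N → Bool) : ℝ :=
  β * (N : ℝ) ^ ((1 : ℤ) - (p : ℤ)) * (∑ i : Fin p → Fin N, ∏ j, spin (x (i j)))
    + h * mag x

/-- The (unnormalized) Gibbs weight of a configuration. -/
def cwWeight (p N : ℕ) (β h : ℝ) (x : Fin N → Bool) : ℝ :=
  Real.exp (cwHamiltonian p N β h x)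

/-- The probability of an event `E` under the `p`-spin Curie-Weiss measure `P_{β,h,p}`. -/
def cwProb (p N : ℕ) (β h : ℝ) (E : Set (Fin N → Bool)) : ℝ :=
  (∑ x : Fin N → Bool, E.indicator (cwWeight p N β h) x) /
    ∑ x : Fin N → Bool, cwWeight p N β h x

/-- Conditional probability of `E` given `A` under the `p`-spin Curie-Weiss measure. -/
def cwCondProb (p N : ℕ) (β h : ℝ) (E A : Set (Fin N → Bool)) : ℝ :=
  cwProb p N β h (E ∩ A) / cwProb p N β h A

/-- The binary entropy function `I(x) = ½[(1+x)log(1+x) + (1-x)log(1-x)]`. -/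
def binEnt (x : ℝ) : ℝ := (1/2) * ((1+x) * Real.log (1+x) + (1-x) * Real.log (1-x))

/-- The function `H_{β,h,p}(x) = βxᵖ + hx - I(x)`. -/
def Hfun (p : ℕ) (β h : ℝ) (x : ℝ) : ℝ := β * x ^ p + h * x - binEnt x

/-- `m` is a global maximizer of `H_{β,h,p}` on `[-1,1]`, lying in `(-1,1)`. -/
def isMaximizer (p : ℕ) (β h m : ℝ) : Prop :=
  m ∈ Set.Ioo (-1 : ℝ) 1 ∧ ∀ x ∈ Set.Icc (-1 : ℝ) 1, Hfun p β h x ≤ Hfun p β h m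

/-- `m` is the unique global maximizer of `H_{β,h,p}`. -/
def isUniqueMaximizer (p : ℕ) (β h m : ℝ) : Prop :=
  isMaximizer p β h m ∧ ∀ m', isMaximizer p β h m' → m' = m

/-- `(β,h)` is a `p`-regular point with unique global maximizer `m`. -/
def pRegular (p : ℕ) (β h m : ℝ) : Prop :=
  isUniqueMaximizer p β h m ∧ iteratedDeriv 2 (Hfun p β h) m < 0

/-- `(β,h)` is a `p`-special point with unique global maximizer `m`. -/
def pSpecial (p : ℕ) (β h m : ℝ) : Prop :=
  isUniqueMaximizer p β h m ∧ iteratedDeriv 2 (Hfun p β h) m = 0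

/-- `(β,h)` is a `p`-critical point: `H_{β,h,p}` has more than one global maximizer. -/
def pCritical (p : ℕ) (β h : ℝ) : Prop :=
  ∃ m₁ m₂, m₁ ≠ m₂ ∧ isMaximizer p β h m₁ ∧ isMaximizer p β h m₂

/-- The probability assigned to a set `S ⊆ ℝ` by the centered Gaussian with variance `v`. -/
def gaussProb (v : ℝ) (S : Set ℝ) : ℝ :=
  ∫ t in S, (Real.sqrt (2 * Real.pi * v))⁻¹ * Real.exp (-t ^ 2 / (2 * v))

/-- The CDF of the centered Gaussian with variance `v`. -/
def gaussCDF (v x : ℝ) : ℝ := gaussProb v (Set.Iic x)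

/-- The standard normal CDF `Φ`. -/
def stdNormCDF (x : ℝ) : ℝ := gaussCDF 1 x

/-- The CDF of the limit law `F` at a `p`-special point, where `c = H⁽⁴⁾(m_*)`:
`dF(x) = (2/Γ(1/4)) (-c/24)^{1/4} exp(c x⁴/24) dx`. -/
def specialCDF (c x : ℝ) : ℝ :=
  ∫ t in Set.Iic x, (2 / Real.Gamma (1/4)) * ((-c) / 24) ^ ((1:ℝ)/4) * Real.exp (c * t ^ 4 / 24)

/-- The inverse hyperbolic tangent `tanh⁻¹(t) = ½ log((1+t)/(1-t))`. -/
def arctanh (t : ℝ) : ℝ := (1/2) * Real.log ((1+t)/(1-t))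

/-- The function `g(t) = tanh⁻¹(t)/(p t^{p-1})`, so that the maximum pseudolikelihood
estimate of `β` is `g(X̄)`. -/
def gMPL (p : ℕ) (t : ℝ) : ℝ := arctanh t / (p * t ^ (p - 1))

/-- The threshold `β*(p) = inf{β ≥ 0 : sup_{x∈[0,1]} H_{β,0,p}(x) > 0}`. -/
def betaStar (p : ℕ) : ℝ := sInf {b : ℝ | 0 ≤ b ∧ ∃ x ∈ Set.Icc (0:ℝ) 1, 0 < Hfun p b 0 x}

lemma hasDerivAt_arctanh {x : ℝ} (h1 : -1 < x) (h2 : x < 1) :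
    HasDerivAt arctanh (1 / (1 - x ^ 2)) x := by
  have ha : (1 + x) ≠ 0 := by linarith
  have hb : (1 - x) ≠ 0 := by linarith
  have hc : (1 - x ^ 2) ≠ 0 := by nlinarith
  have hd : (1 + x) / (1 - x) ≠ 0 := div_ne_zero ha hb
  have := ((((hasDerivAt_id x).const_add 1).div ((hasDerivAt_id x).const_sub 1) hb).log hd).const_mul
    (1 / 2 : ℝ)
  refine this.congr_deriv ?_
  simp only [id, Pi.div_apply]
  have : 1 - x ^ 2 = (1 + x) * (1 - x) := by ring
  rw [this]
  field_simp
  ring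

lemma arctanh_eq {x : ℝ} (h1 : -1 < x) (h2 : x < 1) :
    arctanh x = (1 / 2) * (Real.log (1 + x) - Real.log (1 - x)) := by
  rw [arctanh, Real.log_div (by linarith) (by linarith)]

lemma hasDerivAt_binEnt {x : ℝ} (h1 : -1 < x) (h2 : x < 1) :
    HasDerivAt binEnt (arctanh x) x := by
  have ha : (1 + x) ≠ 0 := by linarith
  have hb : (1 - x) ≠ 0 := by linarith
  have := (((Real.hasDerivAt_mul_log ha).comp x ((hasDerivAt_id x).const_add 1)).add
    ((Real.hasDerivAt_mul_log hb).comp x ((hasDerivAt_id x).const_sub 1))).const_mul (1 / 2 : ℝ)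
  refine this.congr_deriv ?_
  rw [arctanh_eq h1 h2]
  ring

lemma continuous_binEnt : Continuous binEnt := by
  unfold binEnt
  have h := Real.continuous_mul_log
  exact continuous_const.mul ((h.comp (continuous_const.add continuous_id)).add
    (h.comp (continuous_const.sub continuous_id)))

lemma binEnt_neg (x : ℝ) : binEnt (-x) = binEnt x := by
  simp only [binEnt, sub_neg_eq_add, ← sub_eq_add_neg]
  ring

lemma binEnt_zero : binEnt 0 = 0 := by simp [binEnt]

lemma binEnt_nonneg {x : ℝ} (h1 : -1 ≤ x) (h2 : x ≤ 1) : 0 ≤ binEnt x := by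
  have key : ∀ y : ℝ, 0 ≤ y → y - 1 ≤ y * Real.log y := by
    intro y hy
    rcases hy.eq_or_lt with rfl | hy
    · simp
    · have := mul_le_mul_of_nonneg_left (Real.one_sub_inv_le_log_of_pos hy) hy.le
      rwa [mul_sub, mul_one, mul_inv_cancel₀ hy.ne'] at this
  have h3 := key (1 + x) (by linarith)
  have h4 := key (1 - x) (by linarith)
  unfold binEnt
  linarith

lemma continuous_Hfun (p : ℕ) (β h : ℝ) : Continuous (Hfun p β h) := by
  unfold Hfun
  have := continuous_binEnt
  fun_prop

lemma hasDerivAt_Hfun (p : ℕ) (β : ℝ) {x : ℝ} (h1 : -1 < x) (h2 : x < 1) :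
    HasDerivAt (Hfun p β 0) (β * (p * x ^ (p - 1)) - arctanh x) x := by
  have := (((hasDerivAt_pow p x).const_mul β).add ((hasDerivAt_id x).const_mul 0)).sub
    (hasDerivAt_binEnt h1 h2)
  refine this.congr_deriv ?_
  ring

lemma hasDerivAt_deriv_Hfun (p : ℕ) (β : ℝ) {x : ℝ} (h1 : -1 < x) (h2 : x < 1) :
    HasDerivAt (fun x => β * (p * x ^ (p - 1)) - arctanh x)
      (β * (p * ((p - 1 : ℕ) * x ^ (p - 2))) - 1 / (1 - x ^ 2)) x :=
  (((hasDerivAt_pow (p - 1) x).const_mul (p : ℝ)).const_mul β).sub (hasDerivAt_arctanh h1 h2)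

lemma iteratedDeriv_two_Hfun (p : ℕ) (β : ℝ) {x : ℝ} (h1 : -1 < x) (h2 : x < 1) :
    iteratedDeriv 2 (Hfun p β 0) x =
      β * (p * ((p - 1 : ℕ) * x ^ (p - 2))) - 1 / (1 - x ^ 2) := by
  rw [iteratedDeriv_succ, iteratedDeriv_one]
  refine HasDerivAt.deriv ((hasDerivAt_deriv_Hfun p β h1 h2).congr_of_eventuallyEq ?_)
  filter_upwards [Ioo_mem_nhds h1 h2] with y hy
  exact (hasDerivAt_Hfun p β hy.1 hy.2).deriv

lemma Hfun_zero {p : ℕ} (hp : 3 ≤ p) (β : ℝ) : Hfun p β 0 0 = 0 := by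
  simp [Hfun, binEnt_zero, show p ≠ 0 by omega]

/-- Above the threshold the global maximum is positive. -/
lemma Hfun_maximizer_pos {p : ℕ} {β m : ℝ} (hβ : betaStar p < β) (hmax : isMaximizer p β 0 m) :
    0 < Hfun p β 0 m := by
  have hne : {b : ℝ | 0 ≤ b ∧ ∃ x ∈ Set.Icc (0:ℝ) 1, 0 < Hfun p b 0 x}.Nonempty := by
    refine ⟨Real.log 2 + 1, by have := Real.log_pos one_lt_two; linarith, 1, by simp, ?_⟩
    simp [Hfun, binEnt]
    linarith
  obtain ⟨b, ⟨-, x, hx, hpos⟩, hb⟩ := exists_lt_of_csInf_lt hne hβ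
  refine hpos.trans_le (le_trans ?_ (hmax.2 x ⟨by linarith [hx.1], hx.2⟩))
  have := mul_le_mul_of_nonneg_right hb.le (pow_nonneg hx.1 p)
  unfold Hfun
  linarith

lemma maximizer_critical {p : ℕ} {β m : ℝ} (hmax : isMaximizer p β 0 m) :
    β * (p * m ^ (p - 1)) = arctanh m := by
  have hloc : IsLocalMax (Hfun p β 0) m := by
    filter_upwards [Icc_mem_nhds hmax.1.1 hmax.1.2] with y hy using hmax.2 y hy
  have := hloc.hasDerivAt_eq_zero (hasDerivAt_Hfun p β hmax.1.1 hmax.1.2)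
  linarith

/-- The numerator of the derivative of `arctanh x / x ^ (p - 1)`. -/
def slopeNum (p : ℕ) (x : ℝ) : ℝ := x / (1 - x ^ 2) - ((p : ℝ) - 1) * arctanh x

lemma hasDerivAt_slopeNum (p : ℕ) {x : ℝ} (h1 : -1 < x) (h2 : x < 1) :
    HasDerivAt (slopeNum p) ((p * x ^ 2 - (p - 2)) / (1 - x ^ 2) ^ 2) x := by
  have hc : (1 - x ^ 2) ≠ 0 := by nlinarith
  have := ((hasDerivAt_id x).div ((hasDerivAt_pow 2 x).const_sub 1) hc).sub
    ((hasDerivAt_arctanh h1 h2).const_mul ((p : ℝ) - 1))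
  refine this.congr_deriv ?_
  simp only [id]
  field_simp
  push_cast
  ring

lemma slopeNum_zero (p : ℕ) : slopeNum p 0 = 0 := by simp [slopeNum, arctanh]

lemma slopeNum_le_zero_of_small {p : ℕ} {x : ℝ} (hx0 : 0 ≤ x) (hx1 : x < 1)
    (h : p * x ^ 2 ≤ p - 2) : slopeNum p x ≤ 0 := by
  have : AntitoneOn (slopeNum p) (Set.Icc 0 x) := by
    refine antitoneOn_of_hasDerivWithinAt_nonpos (convex_Icc 0 x) (fun y hy =>
      (hasDerivAt_slopeNum p (by linarith [hy.1]) (by linarith [hy.2])).continuousAt.continuousWithinAt)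
      (fun y hy => (hasDerivAt_slopeNum p ?_ ?_).hasDerivWithinAt) (fun y hy => ?_)
    · rw [interior_Icc] at hy; linarith [hy.1]
    · rw [interior_Icc] at hy; linarith [hy.2]
    · rw [interior_Icc] at hy
      refine div_nonpos_of_nonpos_of_nonneg ?_ (sq_nonneg _)
      have : (p : ℝ) * y ^ 2 ≤ p * x ^ 2 :=
        mul_le_mul_of_nonneg_left (pow_le_pow_left₀ hy.1.le hy.2.le 2) (Nat.cast_nonneg p)
      linarith
  simpa [slopeNum_zero] using this ⟨le_rfl, hx0⟩ ⟨hx0, le_rfl⟩ hx0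

lemma slopeNum_mono_of_large {p : ℕ} {x y : ℝ} (hx0 : 0 ≤ x) (hxy : x ≤ y) (hy1 : y < 1)
    (h : p - 2 ≤ p * x ^ 2) : slopeNum p x ≤ slopeNum p y := by
  have : MonotoneOn (slopeNum p) (Set.Icc x y) := by
    refine monotoneOn_of_hasDerivWithinAt_nonneg (convex_Icc x y) (fun z hz =>
      (hasDerivAt_slopeNum p (by linarith [hz.1]) (by linarith [hz.2])).continuousAt.continuousWithinAt)
      (fun z hz => (hasDerivAt_slopeNum p ?_ ?_).hasDerivWithinAt) (fun z hz => ?_)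
    · rw [interior_Icc] at hz; linarith [hz.1]
    · rw [interior_Icc] at hz; linarith [hz.2]
    · rw [interior_Icc] at hz
      refine div_nonneg ?_ (sq_nonneg _)
      have : (p : ℝ) * x ^ 2 ≤ p * z ^ 2 :=
        mul_le_mul_of_nonneg_left (pow_le_pow_left₀ hx0 hz.1.le 2) (Nat.cast_nonneg p)
      linarith
  exact this ⟨le_rfl, hxy⟩ ⟨hxy, le_rfl⟩ hxy

lemma slopeNum_nonpos_of_le {p : ℕ} {x m : ℝ} (hx0 : 0 ≤ x) (hxm : x ≤ m) (hm1 : m < 1)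
    (h : slopeNum p m ≤ 0) : slopeNum p x ≤ 0 := by
  rcases le_total ((p : ℝ) * x ^ 2) (p - 2) with h' | h'
  · exact slopeNum_le_zero_of_small hx0 (by linarith) h'
  · exact (slopeNum_mono_of_large hx0 hxm hm1 h').trans h

lemma slopeNum_pos_of_le {p : ℕ} {x m : ℝ} (hm0 : 0 ≤ m) (hmx : m ≤ x) (hx1 : x < 1)
    (h : 0 < slopeNum p m) : 0 < slopeNum p x := by
  by_contra! hc
  exact absurd (slopeNum_nonpos_of_le hm0 hmx hx1 hc) (not_le.2 h)

lemma hasDerivAt_arctanh_div_pow {p : ℕ} (hp : 3 ≤ p) {x : ℝ} (h1 : 0 < x) (h2 : x < 1) :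
    HasDerivAt (fun x => arctanh x / x ^ (p - 1)) (slopeNum p x / x ^ p) x := by
  obtain ⟨n, rfl⟩ := Nat.exists_eq_add_of_le' hp
  have hc : (1 - x ^ 2) ≠ 0 := by nlinarith
  have := (hasDerivAt_arctanh (by linarith) h2).div (hasDerivAt_pow (n + 3 - 1) x)
    (pow_ne_zero _ h1.ne')
  refine this.congr_deriv ?_
  simp only [slopeNum, show n + 3 - 1 = n + 2 by omega, show n + 2 - 1 = n + 1 by omega]
  push_cast
  field_simp
  ring

/-- At the positive global maximizer the pseudolikelihood map is strictly increasing. -/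
lemma slopeNum_maximizer_pos {p : ℕ} (hp : 3 ≤ p) {β m : ℝ} (hβ : betaStar p < β) (hm : 0 < m)
    (hmax : isMaximizer p β 0 m) : 0 < slopeNum p m := by
  by_contra! hk
  have hm1 := hmax.1.2
  have hG : AntitoneOn (fun x => arctanh x / x ^ (p - 1)) (Set.Ioc 0 m) := by
    refine antitoneOn_of_hasDerivWithinAt_nonpos (f' := fun x => slopeNum p x / x ^ p)
      (convex_Ioc 0 m) (fun y hy =>
      (hasDerivAt_arctanh_div_pow hp hy.1 (by linarith [hy.2])).continuousAt.continuousWithinAt)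
      (fun y hy => (hasDerivAt_arctanh_div_pow hp ?_ ?_).hasDerivWithinAt) (fun y hy => ?_)
    · rw [interior_Ioc] at hy; exact hy.1
    · rw [interior_Ioc] at hy; linarith [hy.2]
    · rw [interior_Ioc] at hy
      exact div_nonpos_of_nonpos_of_nonneg (slopeNum_nonpos_of_le hy.1.le hy.2.le hm1 hk)
        (pow_nonneg hy.1.le _)
  have hH : AntitoneOn (Hfun p β 0) (Set.Icc 0 m) := by
    refine antitoneOn_of_hasDerivWithinAt_nonpos (convex_Icc 0 m)
      (continuous_Hfun p β 0).continuousOn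
      (fun y hy => (hasDerivAt_Hfun p β ?_ ?_).hasDerivWithinAt) (fun y hy => ?_)
    · rw [interior_Icc] at hy; linarith [hy.1]
    · rw [interior_Icc] at hy; linarith [hy.2]
    · rw [interior_Icc] at hy
      have h1 : arctanh m / m ^ (p - 1) ≤ arctanh y / y ^ (p - 1) :=
        hG ⟨hy.1, hy.2.le⟩ ⟨hm, le_rfl⟩ hy.2.le
      rw [← maximizer_critical hmax, ← mul_assoc, mul_div_cancel_right₀ _ (pow_pos hm _).ne',
        le_div_iff₀ (pow_pos hy.1 _)] at h1
      linarith
  have := hH ⟨le_rfl, hm.le⟩ ⟨hm.le, le_rfl⟩ hm.le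
  rw [Hfun_zero hp] at this
  exact absurd (Hfun_maximizer_pos hβ hmax) (not_lt.2 this)

lemma Hfun_lt_of_maximizer_lt {p : ℕ} (hp : 3 ≤ p) {β m : ℝ} (hβ : betaStar p < β) (hm : 0 < m)
    (hmax : isMaximizer p β 0 m) {t : ℝ} (hmt : m < t) (ht : t ≤ 1) :
    Hfun p β 0 t < Hfun p β 0 m := by
  have hk := slopeNum_maximizer_pos hp hβ hm hmax
  have hG : StrictMonoOn (fun x => arctanh x / x ^ (p - 1)) (Set.Ico m 1) := by
    refine strictMonoOn_of_hasDerivWithinAt_pos (f' := fun x => slopeNum p x / x ^ p)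
      (convex_Ico m 1) (fun y hy =>
      (hasDerivAt_arctanh_div_pow hp (hm.trans_le hy.1) hy.2).continuousAt.continuousWithinAt)
      (fun y hy => (hasDerivAt_arctanh_div_pow hp ?_ ?_).hasDerivWithinAt) (fun y hy => ?_)
    · rw [interior_Ico] at hy; linarith [hy.1]
    · rw [interior_Ico] at hy; exact hy.2
    · rw [interior_Ico] at hy
      exact div_pos (slopeNum_pos_of_le hm.le hy.1.le hy.2 hk) (pow_pos (hm.trans hy.1) _)
  have hH : StrictAntiOn (Hfun p β 0) (Set.Icc m 1) := by
    refine strictAntiOn_of_hasDerivWithinAt_neg (convex_Icc m 1)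
      (continuous_Hfun p β 0).continuousOn
      (fun y hy => (hasDerivAt_Hfun p β ?_ ?_).hasDerivWithinAt) (fun y hy => ?_)
    · rw [interior_Icc] at hy; linarith [hy.1]
    · rw [interior_Icc] at hy; exact hy.2
    · rw [interior_Icc] at hy
      have h1 : arctanh m / m ^ (p - 1) < arctanh y / y ^ (p - 1) :=
        hG ⟨le_rfl, hmax.1.2⟩ ⟨hy.1.le, hy.2⟩ hy.1
      rw [← maximizer_critical hmax, ← mul_assoc, mul_div_cancel_right₀ _ (pow_pos hm _).ne',
        lt_div_iff₀ (pow_pos (hm.trans hy.1) _)] at h1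
      linarith
  exact hH ⟨le_rfl, hmax.1.2.le⟩ ⟨hmt.le, ht⟩ hmt

lemma Hfun_neg_even {p : ℕ} (he : Even p) (β t : ℝ) : Hfun p β 0 (-t) = Hfun p β 0 t := by
  simp [Hfun, he.neg_pow, binEnt_neg]

lemma betaStar_nonneg (p : ℕ) : 0 ≤ betaStar p := Real.sInf_nonneg fun _ h => h.1

lemma eq_maximizer_of_Hfun_eq {p : ℕ} (hp : 3 ≤ p) {β m : ℝ} (hβ : betaStar p < β) (hm : 0 < m)
    (hmax : isMaximizer p β 0 m) (huniq : ∀ m', 0 < m' → isMaximizer p β 0 m' → m' = m)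
    {t : ℝ} (h1 : -1 ≤ t) (h2 : t ≤ 1) (h : Hfun p β 0 m ≤ Hfun p β 0 t) :
    t = m ∨ (Even p ∧ t = -m) := by
  have hpos := Hfun_maximizer_pos hβ hmax
  have key : ∀ t : ℝ, 0 < t → t ≤ 1 → Hfun p β 0 m ≤ Hfun p β 0 t → t = m := by
    intro t h0 h2 h
    rcases lt_or_ge m t with hmt | hmt
    · exact absurd (Hfun_lt_of_maximizer_lt hp hβ hm hmax hmt h2) (not_lt.2 h)
    · exact huniq t h0 ⟨⟨by linarith, by linarith [hmax.1.2]⟩,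
        fun x hx => (hmax.2 x hx).trans h⟩
  rcases lt_trichotomy t 0 with ht | ht | ht
  · rcases Nat.even_or_odd p with he | ho
    · refine Or.inr ⟨he, ?_⟩
      rw [← Hfun_neg_even he β t] at h
      linarith [key (-t) (by linarith) (by linarith) h]
    · exfalso
      have h3 : t ^ p < 0 := ho.pow_neg ht
      have h4 := binEnt_nonneg h1 h2
      have h5 : β * t ^ p ≤ 0 :=
        mul_nonpos_of_nonneg_of_nonpos ((betaStar_nonneg p).trans hβ.le) h3.le
      unfold Hfun at h hpos
      linarith
  · rw [ht, Hfun_zero hp] at h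
    linarith
  · exact Or.inl (key t ht h2 h)

/-- Away from the maximizers, `H` stays below its maximum by a fixed amount. -/
lemma exists_gap {p : ℕ} (hp : 3 ≤ p) {β m : ℝ} (hβ : betaStar p < β) (hm : 0 < m)
    (hmax : isMaximizer p β 0 m) (huniq : ∀ m', 0 < m' → isMaximizer p β 0 m' → m' = m)
    {δ : ℝ} (hδ : 0 < δ) :
    ∃ c > 0, ∀ t ∈ Set.Icc (-1 : ℝ) 1, δ ≤ |t - m| → (Even p → δ ≤ |t + m|) →
      Hfun p β 0 t ≤ Hfun p β 0 m - c := by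
  set S : Set ℝ := Set.Icc (-1 : ℝ) 1 ∩ ({t | δ ≤ |t - m|} ∩ {t | Even p → δ ≤ |t + m|}) with hS
  have hcl : IsClosed {t : ℝ | Even p → δ ≤ |t + m|} := by
    by_cases he : Even p
    · simpa [he] using isClosed_le continuous_const (by fun_prop : Continuous fun t : ℝ => |t + m|)
    · simp [he]
  have hcpt : IsCompact S := isCompact_Icc.inter_right
    ((isClosed_le continuous_const (by fun_prop : Continuous fun t : ℝ => |t - m|)).inter hcl)
  rcases S.eq_empty_or_nonempty with he | hne
  · exact ⟨1, one_pos, fun t h1 h2 h3 => absurd (show t ∈ S from ⟨h1, h2, h3⟩) (by simp [he])⟩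
  · obtain ⟨s, hs, hsmax⟩ := hcpt.exists_isMaxOn hne (continuous_Hfun p β 0).continuousOn
    refine ⟨Hfun p β 0 m - Hfun p β 0 s, ?_, fun t h1 h2 h3 => ?_⟩
    · by_contra! hc
      rcases eq_maximizer_of_Hfun_eq hp hβ hm hmax huniq hs.1.1 hs.1.2 (by linarith) with h | ⟨he, h⟩
      · have : δ ≤ |s - m| := hs.2.1
        simp [h] at this; linarith
      · have : δ ≤ |s + m| := hs.2.2 he
        simp [h] at this; linarith
    · have : Hfun p β 0 t ≤ Hfun p β 0 s := hsmax ⟨h1, h2, h3⟩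
      linarith

lemma iteratedDeriv_two_Hfun_maximizer {p : ℕ} (hp : 3 ≤ p) {β m : ℝ} (hm : 0 < m)
    (hmax : isMaximizer p β 0 m) :
    iteratedDeriv 2 (Hfun p β 0) m = -(slopeNum p m / m) := by
  rw [iteratedDeriv_two_Hfun p β hmax.1.1 hmax.1.2, slopeNum, ← maximizer_critical hmax]
  obtain ⟨n, rfl⟩ := Nat.exists_eq_add_of_le' hp
  have hc : (1 - m ^ 2) ≠ 0 := by nlinarith [hmax.1.2]
  simp only [show n + 3 - 1 = n + 2 by omega, show n + 3 - 2 = n + 1 by omega]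
  push_cast
  field_simp
  ring

lemma gMPL_maximizer {p : ℕ} (hp : 3 ≤ p) {β m : ℝ} (hm : 0 < m) (hmax : isMaximizer p β 0 m) :
    gMPL p m = β := by
  have : (p : ℝ) ≠ 0 := by positivity
  rw [gMPL, ← maximizer_critical hmax]
  field_simp

lemma hasDerivAt_gMPL {p : ℕ} (hp : 3 ≤ p) {x : ℝ} (h1 : 0 < x) (h2 : x < 1) :
    HasDerivAt (gMPL p) (slopeNum p x / (p * x ^ p)) x := by
  have : gMPL p = fun x => (p : ℝ)⁻¹ * (arctanh x / x ^ (p - 1)) := by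
    ext x; rw [gMPL, div_mul_eq_div_div_swap, div_eq_inv_mul (_ / _)]
  rw [this]
  refine ((hasDerivAt_arctanh_div_pow hp h1 h2).const_mul _).congr_deriv ?_
  rw [div_mul_eq_div_div_swap, div_eq_inv_mul (_ / _)]

lemma gMPL_neg_even {p : ℕ} (hp : 3 ≤ p) (he : Even p) (t : ℝ) :
    gMPL p (-t) = gMPL p t := by
  have ho : Odd (p - 1) := Nat.Even.sub_odd (by omega) he odd_one
  have harc : arctanh (-t) = -arctanh t := by
    simp only [arctanh, sub_neg_eq_add, ← sub_eq_add_neg]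
    rw [← inv_div (1 + t) (1 - t), Real.log_inv]
    ring
  rw [gMPL, gMPL, ho.neg_pow, harc, mul_neg, neg_div_neg_eq]

/-- Second order Taylor expansion at a critical zero, with a continuous remainder factor. -/
lemma exists_eq_sq_mul {f f' : ℝ → ℝ} {c x₀ : ℝ} (hf : ∀ᶠ x in 𝓝 x₀, HasDerivAt f (f' x) x)
    (h0 : f x₀ = 0) (h0' : f' x₀ = 0) (hf' : HasDerivAt f' c x₀) :
    ∃ R : ℝ → ℝ, ContinuousAt R x₀ ∧ R x₀ = c / 2 ∧ ∀ x, f x = (x - x₀) ^ 2 * R x := by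
  have hlim : Tendsto (fun x => f x / (x - x₀) ^ 2) (𝓝[≠] x₀) (𝓝 (c / 2)) := by
    refine HasDerivAt.lhopital_zero_nhdsNE (f' := f') (g' := fun x => 2 * (x - x₀))
      (hf.filter_mono nhdsWithin_le_nhds) (Eventually.of_forall fun x => ?_) ?_ ?_ ?_ ?_
    · simpa using ((hasDerivAt_id x).sub_const x₀).fun_pow 2
    · filter_upwards [self_mem_nhdsWithin] with x hx
      exact mul_ne_zero two_ne_zero (sub_ne_zero.2 hx)
    · have := hf.self_of_nhds.continuousAt.tendsto
      rw [h0] at this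
      exact this.mono_left nhdsWithin_le_nhds
    · have : ContinuousAt (fun x => (x - x₀) ^ 2) x₀ := by fun_prop
      have := this.tendsto
      simp only [sub_self, ne_eq, OfNat.ofNat_ne_zero, not_false_eq_true, zero_pow] at this
      exact this.mono_left nhdsWithin_le_nhds
    · have := (hasDerivAt_iff_tendsto_slope.1 hf').div_const 2
      refine this.congr' ?_
      filter_upwards [self_mem_nhdsWithin] with x hx
      rw [slope_def_field, h0', sub_zero, div_div, mul_comm]
  refine ⟨Function.update (fun x => f x / (x - x₀) ^ 2) x₀ (c / 2),
    continuousAt_update_same.2 hlim, by simp, fun x => ?_⟩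
  rcases eq_or_ne x x₀ with rfl | hx
  · simp [h0]
  · rw [Function.update_of_ne hx, mul_div_cancel₀ _ (pow_ne_zero 2 (sub_ne_zero.2 hx))]

/-- The exponential tilt left over after comparing the Curie-Weiss weight with the product
measure of mean `m`. -/
def tiltFun (p : ℕ) (β m t : ℝ) : ℝ := β * t ^ p - β * m ^ p - arctanh m * (t - m)

lemma exists_tiltFun_eq {p : ℕ} {β m : ℝ} (hmax : isMaximizer p β 0 m) :
    ∃ R : ℝ → ℝ, ContinuousAt R m ∧
      R m = (iteratedDeriv 2 (Hfun p β 0) m + 1 / (1 - m ^ 2)) / 2 ∧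
      ∀ t, tiltFun p β m t = (t - m) ^ 2 * R t := by
  refine exists_eq_sq_mul (f' := fun t => β * (p * t ^ (p - 1)) - arctanh m)
    (Eventually.of_forall fun t => ?_) (by simp [tiltFun]) (by simp [maximizer_critical hmax]) ?_
  · have := (((hasDerivAt_pow p t).const_mul β).sub_const (β * m ^ p)).sub
      (((hasDerivAt_id t).sub_const m).const_mul (arctanh m))
    refine this.congr_deriv ?_
    ring
  · rw [iteratedDeriv_two_Hfun p β hmax.1.1 hmax.1.2]
    refine ((((hasDerivAt_pow (p - 1) m).const_mul (p : ℝ)).const_mul β).sub_const _).congr_deriv ?_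
    rw [Nat.sub_sub]
    ring

lemma sum_prod_bool {R : Type*} [CommSemiring R] (N : ℕ) (f : Bool → R) :
    ∑ σ : Fin N → Bool, ∏ i, f (σ i) = (f true + f false) ^ N := by
  have := Finset.prod_univ_sum (fun _ : Fin N => (Finset.univ : Finset Bool)) (fun _ b => f b)
  rw [Fintype.piFinset_univ] at this
  simpa using this.symm

lemma spin_true : spin true = 1 := by simp [spin]

lemma spin_false : spin false = -1 := by simp [spin]

lemma spin_not (b : Bool) : spin (!b) = -spin b := by cases b <;> simp [spin]

/-- The weight of a configuration under the product measure with mean `m`. -/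
def prodWeight {N : ℕ} (m : ℝ) (σ : Fin N → Bool) : ℝ := ∏ i, (1 + m * spin (σ i)) / 2

lemma sum_prodWeight (N : ℕ) (m : ℝ) : ∑ σ : Fin N → Bool, prodWeight m σ = 1 := by
  unfold prodWeight
  rw [sum_prod_bool N fun b => (1 + m * spin b) / 2, spin_true, spin_false]
  ring_nf

lemma prodWeight_nonneg {N : ℕ} {m : ℝ} (h1 : -1 ≤ m) (h2 : m ≤ 1) (σ : Fin N → Bool) :
    0 ≤ prodWeight m σ :=
  Finset.prod_nonneg fun i _ => by cases σ i <;> simp only [spin_true, spin_false] <;> linarith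

lemma cwWeight_eq {p N : ℕ} (hN : 0 < N) (β : ℝ) (σ : Fin N → Bool) :
    cwWeight p N β 0 σ = Real.exp (N * (β * (mag σ / N) ^ p)) := by
  have hN' : (N : ℝ) ≠ 0 := by positivity
  have h : ∑ i : Fin p → Fin N, ∏ j, spin (σ (i j)) = mag σ ^ p := by
    have := Finset.prod_univ_sum (fun _ : Fin p => (Finset.univ : Finset (Fin N)))
      (fun _ k => spin (σ k))
    simpa [mag] using this.symm
  rw [cwWeight, cwHamiltonian, h, zpow_sub₀ hN', zpow_one, zpow_natCast, div_pow]
  congr 1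
  field_simp
  ring

lemma abs_mag_le {N : ℕ} (σ : Fin N → Bool) : |mag σ| ≤ N := by
  refine (Finset.abs_sum_le_sum_abs _ _).trans ?_
  have : ∀ i, |spin (σ i)| = 1 := fun i => by cases σ i <;> simp [spin]
  simp [this]

lemma mag_div_mem {N : ℕ} (σ : Fin N → Bool) : mag σ / N ∈ Set.Icc (-1 : ℝ) 1 := by
  have := abs_mag_le σ
  rw [Set.mem_Icc, ← abs_le, abs_div, Nat.abs_cast]
  exact div_le_one_of_le₀ this (Nat.cast_nonneg N)

/-- The Curie-Weiss weight as a tilt of the product weight. -/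
lemma cwWeight_eq_prodWeight {p N : ℕ} (hN : 0 < N) (β : ℝ) {m : ℝ} (h1 : -1 < m) (h2 : m < 1)
    (σ : Fin N → Bool) :
    cwWeight p N β 0 σ = Real.exp (N * (Hfun p β 0 m + Real.log 2)) *
      (prodWeight m σ * Real.exp (N * tiltFun p β m (mag σ / N))) := by
  have hN' : (N : ℝ) ≠ 0 := by positivity
  have hq : prodWeight m σ = Real.exp (N * ((Real.log (1 + m) + Real.log (1 - m)) / 2 - Real.log 2)
      + mag σ * arctanh m) := by
    have : ∀ b : Bool, (1 + m * spin b) / 2 =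
        Real.exp (((Real.log (1 + m) + Real.log (1 - m)) / 2 - Real.log 2)
          + spin b * arctanh m) := by
      intro b
      rw [arctanh_eq h1 h2]
      cases b
      · rw [spin_false, show ((Real.log (1 + m) + Real.log (1 - m)) / 2 - Real.log 2)
          + -1 * (1 / 2 * (Real.log (1 + m) - Real.log (1 - m))) =
          Real.log (1 - m) - Real.log 2 by ring, Real.exp_sub, Real.exp_log (by linarith),
          Real.exp_log two_pos]
        ring
      · rw [spin_true, show ((Real.log (1 + m) + Real.log (1 - m)) / 2 - Real.log 2)
          + 1 * (1 / 2 * (Real.log (1 + m) - Real.log (1 - m))) =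
          Real.log (1 + m) - Real.log 2 by ring, Real.exp_sub, Real.exp_log (by linarith),
          Real.exp_log two_pos]
        ring
    simp only [prodWeight, this]
    rw [← Real.exp_sum, Finset.sum_add_distrib, ← Finset.sum_mul]
    simp [mag, mul_sub]
  rw [cwWeight_eq hN, hq, ← Real.exp_add, ← Real.exp_add, tiltFun, Hfun, binEnt, arctanh_eq h1 h2]
  congr 1
  field_simp
  ring

lemma exp_entropy_le_prodWeight {N : ℕ} (hN : 0 < N) (σ : Fin N → Bool) :
    Real.exp (N * (binEnt (mag σ / N) - Real.log 2)) = prodWeight (mag σ / N) σ := by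
  have hN' : (0 : ℝ) < N := by positivity
  set t := mag σ / N with ht
  have hmem := mag_div_mem σ
  have hmag : mag σ = N * t := by rw [ht]; field_simp
  have hpos : ∀ i, 0 < (1 + t * spin (σ i)) / 2 := by
    intro i
    have hone : ∀ j, 0 ≤ 1 + spin (σ j) * spin (σ i) := fun j => by
      cases σ i <;> cases σ j <;> norm_num [spin]
    have h2 : (2 : ℝ) ≤ ∑ j, (1 + spin (σ j) * spin (σ i)) := by
      refine le_trans ?_ (Finset.single_le_sum (fun j _ => hone j) (Finset.mem_univ i))
      cases σ i <;> norm_num [spin]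
    rw [Finset.sum_add_distrib, ← Finset.sum_mul] at h2
    change _ ≤ _ + mag σ * _ at h2
    rw [hmag] at h2
    simp only [Finset.sum_const, Finset.card_univ, Fintype.card_fin, nsmul_eq_mul, mul_one] at h2
    have : 0 < N * (1 + t * spin (σ i)) := by linarith
    exact half_pos (pos_of_mul_pos_right this hN'.le)
  have hmul : ∀ y : ℝ, 0 ≤ y → y * Real.log (y / 2) = y * Real.log y - y * Real.log 2 := by
    intro y hy
    rcases hy.eq_or_lt with rfl | hy
    · simp
    · rw [Real.log_div hy.ne' two_ne_zero]; ring
  have hlog : ∀ b : Bool, Real.log ((1 + t * spin b) / 2) =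
      (1 + spin b) / 2 * Real.log ((1 + t) / 2) + (1 - spin b) / 2 * Real.log ((1 - t) / 2) := by
    intro b
    cases b <;> norm_num [spin, ← sub_eq_add_neg]
  have e1 := hmul (1 + t) (by linarith [hmem.1])
  have e2 := hmul (1 - t) (by linarith [hmem.2])
  rw [prodWeight, ← Real.exp_log (Finset.prod_pos fun i _ => hpos i),
    Real.log_prod (fun i _ => (hpos i).ne')]
  congr 1
  simp only [hlog]
  rw [Finset.sum_add_distrib, ← Finset.sum_mul, ← Finset.sum_mul, ← Finset.sum_div,
    ← Finset.sum_div, Finset.sum_add_distrib, Finset.sum_sub_distrib]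
  simp only [Finset.sum_const, Finset.card_univ, Fintype.card_fin, nsmul_eq_mul, mul_one]
  change _ = (_ + mag σ) / 2 * _ + (_ - mag σ) / 2 * _
  rw [hmag, binEnt]
  linear_combination (-(N : ℝ) / 2) * e1 + (-(N : ℝ) / 2) * e2

lemma exists_mag_eq {N : ℕ} (σ : Fin N → Bool) : ∃ k ∈ Finset.range (N + 1),
    mag σ = 2 * (k : ℝ) - N := by
  refine ⟨(Finset.univ.filter fun i => σ i = true).card, ?_, ?_⟩
  · rw [Finset.mem_range, Nat.lt_succ_iff]
    simpa using Finset.card_filter_le (Finset.univ : Finset (Fin N)) fun i => σ i = true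
  · have : ∀ b : Bool, spin b = 2 * (if b = true then 1 else 0) - 1 := fun b => by
      cases b <;> norm_num [spin]
    simp only [mag, this]
    rw [Finset.sum_sub_distrib, ← Finset.mul_sum, Finset.sum_boole]
    simp

/-- Total Curie-Weiss weight of a region where `H ≤ M`. -/
lemma sum_cwWeight_le {p N : ℕ} (hN : 0 < N) (β M : ℝ) (S : Finset (Fin N → Bool))
    (hS : ∀ σ ∈ S, Hfun p β 0 (mag σ / N) ≤ M) :
    ∑ σ ∈ S, cwWeight p N β 0 σ ≤ (N + 1) * Real.exp (N * (M + Real.log 2)) := by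
  have hN' : (0 : ℝ) < N := by positivity
  have hk : ∀ k ∈ Finset.range (N + 1), (2 * (k : ℝ) - N) / N ∈ Set.Icc (-1 : ℝ) 1 := by
    intro k hk
    have : (k : ℝ) ≤ N := by exact_mod_cast Nat.lt_succ_iff.1 (Finset.mem_range.1 hk)
    have : (0 : ℝ) ≤ k := Nat.cast_nonneg k
    constructor
    · rw [le_div_iff₀ hN']; linarith
    · rw [div_le_iff₀ hN']; linarith
  have hle : ∀ σ ∈ S, cwWeight p N β 0 σ ≤
      (∑ k ∈ Finset.range (N + 1), prodWeight ((2 * (k : ℝ) - N) / N) σ) *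
        Real.exp (N * (M + Real.log 2)) := by
    intro σ hσ
    have h1 : cwWeight p N β 0 σ = prodWeight (mag σ / N) σ *
        Real.exp (N * (Hfun p β 0 (mag σ / N) + Real.log 2)) := by
      rw [cwWeight_eq hN, ← exp_entropy_le_prodWeight hN, ← Real.exp_add, Hfun]
      congr 1
      ring
    rw [h1]
    obtain ⟨k, hkm, hk2⟩ := exists_mag_eq σ
    refine mul_le_mul ?_ ?_ (Real.exp_pos _).le (Finset.sum_nonneg fun k hk' =>
      prodWeight_nonneg (hk k hk').1 (hk k hk').2 σ)
    · rw [hk2]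
      exact Finset.single_le_sum (f := fun k : ℕ => prodWeight ((2 * (k : ℝ) - N) / N) σ)
        (fun k hk' => prodWeight_nonneg (hk k hk').1 (hk k hk').2 σ) hkm
    · gcongr
      exact hS σ hσ
  refine (Finset.sum_le_sum hle).trans ?_
  rw [← Finset.sum_mul]
  gcongr
  refine (Finset.sum_le_univ_sum_of_nonneg fun σ => Finset.sum_nonneg fun k hk' =>
      prodWeight_nonneg (hk k hk').1 (hk k hk').2 σ).trans ?_
  rw [Finset.sum_comm]
  simp [sum_prodWeight]

/-- The law of `X` under the finitely supported weights `w`. -/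
def finiteLaw {ι : Type*} [Fintype ι] (w X : ι → ℝ) : Measure ℝ :=
  ∑ i, ENNReal.ofReal (w i) • Measure.dirac (X i)

lemma isProbabilityMeasure_finiteLaw {ι : Type*} [Fintype ι] {w : ι → ℝ} (X : ι → ℝ)
    (hw : ∀ i, 0 ≤ w i) (h1 : ∑ i, w i = 1) : IsProbabilityMeasure (finiteLaw w X) := by
  constructor
  rw [finiteLaw, Measure.finsetSum_apply]
  simp only [Measure.smul_apply, measure_univ, smul_eq_mul, mul_one]
  rw [← ENNReal.ofReal_sum_of_nonneg fun i _ => hw i, h1, ENNReal.ofReal_one]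

lemma integral_finiteLaw {ι E : Type*} [Fintype ι] [NormedAddCommGroup E] [NormedSpace ℝ E]
    [CompleteSpace E] {w : ι → ℝ} (X : ι → ℝ) (hw : ∀ i, 0 ≤ w i) (f : ℝ → E) :
    ∫ x, f x ∂(finiteLaw w X) = ∑ i, w i • f (X i) := by
  rw [finiteLaw, integral_finsetSum_measure]
  · simp [integral_smul_measure, ENNReal.toReal_ofReal (hw _)]
  · intro i _
    exact Integrable.smul_measure (integrable_dirac (by simp)) ENNReal.ofReal_ne_top

/-- One standardized spin. -/
def stdSpin (m : ℝ) (b : Bool) : ℝ := (spin b - m) / √(1 - m ^ 2)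

/-- The standardized magnetization under the product measure with mean `m`. -/
def stdMag (m : ℝ) {N : ℕ} (σ : Fin N → Bool) : ℝ := (√N)⁻¹ * ∑ i, stdSpin m (σ i)

lemma sum_prodWeight_mul_prod {R : Type*} [CommSemiring R] [Algebra ℝ R] (N : ℕ) (m : ℝ)
    (f : Bool → R) :
    ∑ σ : Fin N → Bool, prodWeight m σ • ∏ i, f (σ i) =
      (∑ b, ((1 + m * spin b) / 2) • f b) ^ N := by
  have := sum_prod_bool N fun b => ((1 + m * spin b) / 2) • f b
  rw [Fintype.sum_bool, ← this]
  refine Finset.sum_congr rfl fun σ _ => ?_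
  rw [Finset.prod_smul, prodWeight]

lemma sum_prodWeight_exp (N : ℕ) (m s : ℝ) :
    ∑ σ : Fin N → Bool, prodWeight m σ * Real.exp (s * stdMag m σ) =
      (∑ b, ((1 + m * spin b) / 2) * Real.exp ((√N)⁻¹ * s * stdSpin m b)) ^ N := by
  have := sum_prodWeight_mul_prod N m fun b => Real.exp ((√N)⁻¹ * s * stdSpin m b)
  simp only [smul_eq_mul, ← Real.exp_sum] at this
  rw [← this]
  refine Finset.sum_congr rfl fun σ _ => ?_
  rw [stdMag, ← Finset.mul_sum]
  ring_nf

lemma mag_div_eq {N : ℕ} (hN : 0 < N) {m : ℝ} (h1 : -1 < m) (h2 : m < 1) (σ : Fin N → Bool) :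
    mag σ / N = m + √(1 - m ^ 2) * stdMag m σ / √N := by
  have hN' : (0 : ℝ) < N := by positivity
  have hs : √(1 - m ^ 2) ≠ 0 := (Real.sqrt_pos.2 (by nlinarith)).ne'
  have hn : √(N : ℝ) ≠ 0 := (Real.sqrt_pos.2 hN').ne'
  have hsum : ∑ i, stdSpin m (σ i) = (mag σ - N * m) / √(1 - m ^ 2) := by
    simp only [stdSpin]
    rw [← Finset.sum_div, Finset.sum_sub_distrib]
    simp [mag]
  rw [stdMag, hsum]
  field_simp
  rw [Real.sq_sqrt hN'.le]
  ring

lemma spinWeight_nonneg {m : ℝ} (h1 : -1 < m) (h2 : m < 1) (b : Bool) :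
    0 ≤ (1 + m * spin b) / 2 := by
  cases b <;> simp only [spin_true, spin_false] <;> linarith

/-- Central limit theorem for the magnetization under the product measure. -/
lemma tendsto_stdMag {m : ℝ} (h1 : -1 < m) (h2 : m < 1) (f : BoundedContinuousFunction ℝ ℝ) :
    Tendsto (fun N : ℕ => ∑ σ : Fin N → Bool, prodWeight m σ * f (stdMag m σ)) atTop
      (𝓝 (∫ x, f x ∂(ProbabilityTheory.gaussianReal 0 1))) := by
  have hv : 0 < 1 - m ^ 2 := by nlinarith
  have hs : √(1 - m ^ 2) ≠ 0 := (Real.sqrt_pos.2 hv).ne'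
  have hw := spinWeight_nonneg h1 h2
  have hb : IsProbabilityMeasure (finiteLaw (fun b => (1 + m * spin b) / 2) (stdSpin m)) :=
    isProbabilityMeasure_finiteLaw _ hw (by simp [spin]; ring)
  have hprob (N : ℕ) : IsProbabilityMeasure
      (finiteLaw (fun σ : Fin N → Bool => prodWeight m σ) (stdMag m)) :=
    isProbabilityMeasure_finiteLaw _ (prodWeight_nonneg h1.le h2.le) (sum_prodWeight N m)
  let μs : ℕ → ProbabilityMeasure ℝ := fun N => ⟨_, hprob N⟩
  let μ : ProbabilityMeasure ℝ := ⟨ProbabilityTheory.gaussianReal 0 1, inferInstance⟩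
  have hlim : Tendsto μs atTop (𝓝 μ) := by
    refine ProbabilityMeasure.tendsto_iff_tendsto_charFun.2 fun t => ?_
    have key := ProbabilityTheory.tendsto_charFun_inv_sqrt_mul_pow
      (P := finiteLaw (fun b => (1 + m * spin b) / 2) (stdSpin m)) (X := id) aemeasurable_id
      (by
        rw [integral_finiteLaw _ hw]
        simp [stdSpin, spin]
        field_simp
        ring)
      (by
        rw [integral_finiteLaw _ hw]
        simp [stdSpin, spin, div_pow, Real.sq_sqrt hv.le]
        field_simp
        ring) t
    rw [Measure.map_id] at key
    have hlimit : charFun (μ : Measure ℝ) t = Complex.exp (-t ^ 2 / 2) := by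
      simp [μ, ProbabilityTheory.charFun_gaussianReal, neg_div]
    rw [hlimit]
    refine key.congr fun N => ?_
    change _ = charFun (finiteLaw (fun σ : Fin N → Bool => prodWeight m σ) (stdMag m)) t
    rw [charFun_apply_real, charFun_apply_real, integral_finiteLaw _ hw,
      integral_finiteLaw _ (prodWeight_nonneg h1.le h2.le), ← sum_prodWeight_mul_prod]
    refine Finset.sum_congr rfl fun σ _ => ?_
    rw [← Complex.exp_sum, stdMag, ← Finset.sum_mul, ← Finset.mul_sum]
    push_cast
    ring_nf
  have := ProbabilityMeasure.tendsto_iff_forall_integral_tendsto.1 hlim f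
  refine this.congr fun N => ?_
  exact integral_finiteLaw _ (prodWeight_nonneg h1.le h2.le) _

/-- The variance proxy of a standardized spin is close to one near the origin. -/
lemma exists_mgf_stdSpin_le {m : ℝ} (h1 : -1 < m) (h2 : m < 1) {v : ℝ} (hv : 1 < v) :
    ∃ s₀ > 0, ∀ s : ℝ, |s| ≤ s₀ →
      ∑ b, ((1 + m * spin b) / 2) * Real.exp (s * stdSpin m b) ≤ Real.exp (v / 2 * s ^ 2) := by
  have hm : 0 < 1 - m ^ 2 := by nlinarith
  have hs : √(1 - m ^ 2) ≠ 0 := (Real.sqrt_pos.2 hm).ne'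
  have hexp : ∀ b s, HasDerivAt (fun s => Real.exp (s * stdSpin m b))
      (stdSpin m b * Real.exp (s * stdSpin m b)) s := fun b s => by
    simpa [mul_comm] using ((hasDerivAt_id s).mul_const (stdSpin m b)).exp
  obtain ⟨R, hRc, hR0, hR⟩ := exists_eq_sq_mul (x₀ := 0) (c := 1)
    (f := fun s => ∑ b, ((1 + m * spin b) / 2) * Real.exp (s * stdSpin m b) - 1)
    (f' := fun s => ∑ b, ((1 + m * spin b) / 2) * (stdSpin m b * Real.exp (s * stdSpin m b)))
    (Eventually.of_forall fun s =>
      (HasDerivAt.fun_sum fun b _ => (hexp b s).const_mul _).sub_const 1)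
    (by simp [spin]; ring)
    (by simp [stdSpin, spin]; field_simp; ring)
    (by
      refine (HasDerivAt.fun_sum fun b _ =>
        ((hexp b 0).const_mul (stdSpin m b)).const_mul ((1 + m * spin b) / 2)).congr_deriv ?_
      have h3 := Real.sq_sqrt hm.le
      simp [stdSpin, spin]
      field_simp
      rw [h3]
      ring)
  have hlt : R 0 < v / 2 := by rw [hR0]; linarith
  obtain ⟨ε, hε, hball⟩ := Metric.eventually_nhds_iff.1 (hRc.eventually_lt_const hlt)
  refine ⟨ε / 2, half_pos hε, fun s hs => ?_⟩
  have h3 : R s < v / 2 := hball (by rw [Real.dist_eq, sub_zero]; linarith)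
  have h4 := hR s
  simp only [sub_zero] at h4
  have h5 : s ^ 2 * R s ≤ v / 2 * s ^ 2 := by nlinarith [sq_nonneg s]
  linarith [Real.add_one_le_exp (v / 2 * s ^ 2)]

lemma summable_exp_neg_mul_int_sq {c : ℝ} (hc : 0 < c) :
    Summable fun k : ℤ => Real.exp (-c * (k : ℝ) ^ 2) := by
  have h : Summable fun n : ℕ => Real.exp (-c * (n : ℝ) ^ 2) := by
    refine Summable.of_nonneg_of_le (fun n => (Real.exp_pos _).le) (fun n => ?_)
      (Real.summable_exp_nat_mul_iff.2 (neg_lt_zero.2 hc))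
    rw [Real.exp_le_exp]
    have : (n : ℝ) ≤ (n : ℝ) ^ 2 := by exact_mod_cast Nat.le_self_pow two_ne_zero n
    nlinarith
  exact Summable.of_nat_of_neg (by simpa using h) (by simpa using h)

/-- Gaussian moments of the standardized magnetization, restricted to a moderate region, are
bounded uniformly in `N`. -/
lemma exists_gaussian_moment_bound {m : ℝ} (h1 : -1 < m) (h2 : m < 1) {a : ℝ} (ha0 : 0 < a)
    (ha1 : a < 1) :
    ∃ δ > 0, ∃ M : ℝ, ∀ᶠ N : ℕ in atTop,
      ∑ σ : Fin N → Bool with |stdMag m σ| ≤ δ * √N,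
        prodWeight m σ * Real.exp (a / 2 * stdMag m σ ^ 2) ≤ M := by
  obtain ⟨v, hv1, hv2⟩ := exists_between ((one_lt_inv₀ ha0).2 ha1)
  obtain ⟨s₀, hs₀, hmgf⟩ := exists_mgf_stdSpin_le h1 h2 hv1
  have hc : 0 < (a⁻¹ - v) / 2 := by linarith
  have hsum := summable_exp_neg_mul_int_sq hc
  have hround : ∀ x : ℝ, Real.exp (a / 2 * x ^ 2) ≤ Real.exp (1 / (8 * a)) *
      Real.exp (round (a * x) * x - (round (a * x) : ℝ) ^ 2 / (2 * a)) := by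
    intro x
    rw [← Real.exp_add, Real.exp_le_exp]
    have h3 := abs_le.1 (abs_sub_round (a * x))
    have h4 : (a * x - round (a * x)) ^ 2 ≤ 1 / 4 := by nlinarith
    have h5 : (a * x - round (a * x)) ^ 2 / (2 * a) ≤ 1 / 4 / (2 * a) := by gcongr
    have h6 : (a * x - round (a * x)) ^ 2 / (2 * a) =
        a / 2 * x ^ 2 - (round (a * x) * x - (round (a * x) : ℝ) ^ 2 / (2 * a)) := by
      field_simp; ring
    have h7 : 1 / 4 / (2 * a) = 1 / (8 * a) := by rw [div_div]; ring_nf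
    linarith
  refine ⟨s₀ / 2, half_pos hs₀, Real.exp (1 / (8 * a)) *
    ∑' k : ℤ, Real.exp (-((a⁻¹ - v) / 2) * (k : ℝ) ^ 2), ?_⟩
  have hlarge : ∀ᶠ N : ℕ in atTop, s₀⁻¹ ≤ √(N : ℝ) :=
    (Real.tendsto_sqrt_atTop.comp tendsto_natCast_atTop_atTop).eventually_ge_atTop _
  filter_upwards [hlarge, eventually_gt_atTop 0] with N hN hN0
  have hN' : (0 : ℝ) < N := by positivity
  have hn : 0 < √(N : ℝ) := Real.sqrt_pos.2 hN'
  have hq := fun σ : Fin N → Bool => prodWeight_nonneg h1.le h2.le σ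
  set L : ℤ := ⌊s₀ * √(N : ℝ)⌋ with hL
  have hone : 1 ≤ s₀ * √(N : ℝ) := by
    rwa [inv_le_iff_one_le_mul₀' hs₀] at hN
  have hpt : ∀ σ ∈ (Finset.univ.filter fun σ : Fin N → Bool => |stdMag m σ| ≤ s₀ / 2 * √N),
      prodWeight m σ * Real.exp (a / 2 * stdMag m σ ^ 2) ≤
        ∑ k ∈ Finset.Icc (-L) L, Real.exp (1 / (8 * a)) * Real.exp (-((k : ℝ) ^ 2 / (2 * a))) *
          (prodWeight m σ * Real.exp (k * stdMag m σ)) := by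
    intro σ hσ
    have hσ' : |stdMag m σ| ≤ s₀ / 2 * √N := (Finset.mem_filter.1 hσ).2
    have hmem : round (a * stdMag m σ) ∈ Finset.Icc (-L) L := by
      have h3 := abs_le.1 (abs_sub_round (a * stdMag m σ))
      have h4 : |a * stdMag m σ| ≤ s₀ / 2 * √N := by
        rw [abs_mul, abs_of_pos ha0]
        nlinarith [abs_nonneg (stdMag m σ)]
      have h5 := abs_le.1 h4
      rw [Finset.mem_Icc, neg_le, hL, Int.le_floor, Int.le_floor]
      push_cast
      constructor <;> linarith
    refine le_trans ?_ (Finset.single_le_sum (f := fun k : ℤ => Real.exp (1 / (8 * a)) *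
      Real.exp (-((k : ℝ) ^ 2 / (2 * a))) * (prodWeight m σ * Real.exp (k * stdMag m σ)))
      (fun k _ => mul_nonneg (by positivity) (mul_nonneg (hq σ) (Real.exp_pos _).le)) hmem)
    have := mul_le_mul_of_nonneg_left (hround (stdMag m σ)) (hq σ)
    rw [sub_eq_add_neg, Real.exp_add] at this
    refine this.trans_eq ?_
    ring
  refine (Finset.sum_le_sum hpt).trans ?_
  rw [Finset.sum_comm]
  calc ∑ k ∈ Finset.Icc (-L) L, ∑ σ : Fin N → Bool with |stdMag m σ| ≤ s₀ / 2 * √N,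
        Real.exp (1 / (8 * a)) * Real.exp (-((k : ℝ) ^ 2 / (2 * a))) *
          (prodWeight m σ * Real.exp (k * stdMag m σ))
      ≤ ∑ k ∈ Finset.Icc (-L) L, Real.exp (1 / (8 * a)) *
          Real.exp (-((a⁻¹ - v) / 2) * (k : ℝ) ^ 2) := by
        refine Finset.sum_le_sum fun k hk => ?_
        have hk' : |(√(N : ℝ))⁻¹ * k| ≤ s₀ := by
          rw [Finset.mem_Icc, neg_le, hL, Int.le_floor, Int.le_floor] at hk
          push_cast at hk
          have : |(k : ℝ)| ≤ s₀ * √(N : ℝ) := abs_le.2 ⟨by linarith [hk.1], hk.2⟩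
          rw [abs_mul, abs_of_pos (inv_pos.2 hn), inv_mul_le_iff₀ hn]
          linarith
        rw [← Finset.mul_sum]
        have h3 : ∑ σ : Fin N → Bool with |stdMag m σ| ≤ s₀ / 2 * √N,
            prodWeight m σ * Real.exp (k * stdMag m σ) ≤ Real.exp (v / 2 * (k : ℝ) ^ 2) := by
          refine (Finset.sum_le_univ_sum_of_nonneg fun σ =>
            mul_nonneg (hq σ) (Real.exp_pos _).le).trans ?_
          rw [sum_prodWeight_exp]
          refine (pow_le_pow_left₀ (Finset.sum_nonneg fun b _ =>
            mul_nonneg (spinWeight_nonneg h1 h2 b) (Real.exp_pos _).le) (hmgf _ hk') N).trans_eq ?_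
          rw [← Real.exp_nat_mul, mul_pow, inv_pow, Real.sq_sqrt hN'.le]
          congr 1
          field_simp
        calc _ ≤ Real.exp (1 / (8 * a)) * Real.exp (-((k : ℝ) ^ 2 / (2 * a))) *
              Real.exp (v / 2 * (k : ℝ) ^ 2) := by gcongr
          _ = _ := by
            rw [mul_assoc, ← Real.exp_add]
            congr 2
            field_simp
            ring
    _ ≤ _ := by
        rw [← Finset.mul_sum]
        gcongr
        exact hsum.sum_le_tsum _ fun k _ => (Real.exp_pos _).le

/-- The piecewise linear cutoff equal to `1` on `[-K, K]` and to `0` off `[-K - 1, K + 1]`. -/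
def cutoff (K u : ℝ) : ℝ := max 0 (min 1 (K + 1 - |u|))

lemma cutoff_nonneg (K u : ℝ) : 0 ≤ cutoff K u := le_max_left _ _

lemma cutoff_le_one (K u : ℝ) : cutoff K u ≤ 1 := max_le zero_le_one (min_le_left _ _)

lemma cutoff_eq_one {K u : ℝ} (h : |u| ≤ K) : cutoff K u = 1 := by
  rw [cutoff, min_eq_left (by linarith), max_eq_right zero_le_one]

lemma cutoff_eq_zero {K u : ℝ} (h : K + 1 ≤ |u|) : cutoff K u = 0 := by
  rw [cutoff, max_eq_left ((min_le_right _ _).trans (by linarith))]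

lemma continuous_cutoff (K : ℝ) : Continuous (cutoff K) := by
  unfold cutoff; fun_prop

lemma hasCompactSupport_cutoff (K : ℝ) : HasCompactSupport (cutoff K) := by
  refine HasCompactSupport.of_support_subset_isCompact (isCompact_Icc (a := -(K + 1)) (b := K + 1))
    fun u hu => ?_
  by_contra hc
  refine hu (cutoff_eq_zero ?_)
  rw [Set.mem_Icc, ← abs_le] at hc
  exact (not_le.1 hc).le

/-- Convergence of expectations of locally uniformly convergent, uniformly integrable functions
along a weakly convergent sequence of finitely supported laws. -/
lemma tendsto_sum_of_tendsto_prod {ι : ℕ → Type*} [∀ N, Fintype (ι N)]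
    {q U : ∀ N, ι N → ℝ} {γ : Measure ℝ} (hq : ∀ N i, 0 ≤ q N i) (hq1 : ∀ N, ∑ i, q N i = 1)
    (hweak : ∀ f : BoundedContinuousFunction ℝ ℝ,
      Tendsto (fun N => ∑ i, q N i * f (U N i)) atTop (𝓝 (∫ x, f x ∂γ)))
    {F : ℕ → ℝ → ℝ} {G : ℝ → ℝ} (hG : Continuous G) (hGint : Integrable G γ)
    (hloc : ∀ u, Tendsto (fun z : ℕ × ℝ => F z.1 z.2) (atTop ×ˢ 𝓝 u) (𝓝 (G u)))
    (htail : ∀ ε > 0, ∀ᶠ K : ℕ in atTop, ∀ᶠ N in atTop,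
      ∑ i with (K : ℝ) < |U N i|, q N i * |F N (U N i)| ≤ ε) :
    Tendsto (fun N => ∑ i, q N i * F N (U N i)) atTop (𝓝 (∫ x, G x ∂γ)) := by
  have hcut : Tendsto (fun K : ℕ => ∫ x, G x * cutoff K x ∂γ) atTop (𝓝 (∫ x, G x ∂γ)) := by
    refine tendsto_integral_of_dominated_convergence (fun x => ‖G x‖)
      (fun K => (hG.mul (continuous_cutoff K)).aestronglyMeasurable) hGint.norm
      (fun K => Eventually.of_forall fun x => ?_) (Eventually.of_forall fun x => ?_)
    · rw [norm_mul, Real.norm_of_nonneg (cutoff_nonneg _ _)]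
      exact mul_le_of_le_one_right (norm_nonneg _) (cutoff_le_one _ _)
    · refine tendsto_const_nhds.congr' ?_
      filter_upwards [eventually_ge_atTop ⌈|x|⌉₊] with K hK
      rw [cutoff_eq_one (Nat.ceil_le.1 hK), mul_one]
  have hunif : TendstoLocallyUniformly F G atTop := by
    refine tendstoLocallyUniformly_iff_forall_tendsto.2 fun x => ?_
    exact (((hG.tendsto x).comp tendsto_snd).prodMk_nhds (hloc x)).mono_right (nhds_le_uniformity (G x))
  rw [Metric.tendsto_nhds]
  intro ε hε
  obtain ⟨K, hK1, hK2⟩ := ((htail (ε / 5) (by positivity)).and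
    (Metric.tendsto_nhds.1 hcut (ε / 5) (by positivity))).exists
  have hcs : HasCompactSupport fun x => G x * cutoff K x := (hasCompactSupport_cutoff K).mul_left
  have hcc : Continuous fun x => G x * cutoff K x := hG.mul (continuous_cutoff K)
  obtain ⟨B, hB⟩ := hcs.exists_bound_of_continuous hcc
  have hw := hweak (BoundedContinuousFunction.ofNormedAddCommGroup _ hcc B hB)
  simp only [BoundedContinuousFunction.coe_ofNormedAddCommGroup] at hw
  have hu := Metric.tendstoUniformlyOn_iff.1 ((tendstoLocallyUniformlyOn_iff_tendstoUniformlyOn_of_compact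
    (isCompact_Icc (a := -((K : ℝ) + 1)) (b := K + 1))).1 hunif.tendstoLocallyUniformlyOn)
    (ε / 5) (by positivity)
  filter_upwards [hK1, Metric.tendsto_nhds.1 hw (ε / 5) (by positivity), hu] with N h1 h2 h3
  rw [Real.dist_eq] at hK2 h2 ⊢
  have h4 : |∑ i, q N i * F N (U N i) - ∑ i, q N i * (G (U N i) * cutoff K (U N i))| ≤
      ε / 5 + ε / 5 := by
    rw [← Finset.sum_sub_distrib]
    refine (Finset.abs_sum_le_sum_abs _ _).trans ?_
    have h5 : ∀ i, |q N i * F N (U N i) - q N i * (G (U N i) * cutoff K (U N i))| ≤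
        (if (K : ℝ) < |U N i| then q N i * |F N (U N i)| else 0) + q N i * (ε / 5) := by
      intro i
      have hd : |F N (U N i) - G (U N i)| * cutoff K (U N i) ≤ ε / 5 := by
        rcases le_or_gt ((K : ℝ) + 1) |U N i| with h | h
        · rw [cutoff_eq_zero h, mul_zero]; positivity
        · have := h3 (U N i) (abs_le.1 h.le)
          rw [dist_comm, Real.dist_eq] at this
          exact (mul_le_of_le_one_right (abs_nonneg _) (cutoff_le_one _ _)).trans this.le
      have he : |F N (U N i)| * (1 - cutoff K (U N i)) ≤
          if (K : ℝ) < |U N i| then |F N (U N i)| else 0 := by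
        split_ifs with h
        · exact mul_le_of_le_one_right (abs_nonneg _) (by linarith [cutoff_nonneg K (U N i)])
        · rw [cutoff_eq_one (not_lt.1 h), sub_self, mul_zero]
      rw [← mul_sub, abs_mul, abs_of_nonneg (hq N i), ← mul_ite_zero, ← mul_add]
      refine mul_le_mul_of_nonneg_left (le_trans ?_ (add_le_add he hd)) (hq N i)
      calc |F N (U N i) - G (U N i) * cutoff K (U N i)|
          = |F N (U N i) * (1 - cutoff K (U N i)) +
              (F N (U N i) - G (U N i)) * cutoff K (U N i)| := by ring_nf
        _ ≤ _ := abs_add_le _ _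
        _ = _ := by
          rw [abs_mul, abs_mul, abs_of_nonneg (cutoff_nonneg K (U N i)),
            abs_of_nonneg (sub_nonneg.2 (cutoff_le_one K (U N i)))]
    refine (Finset.sum_le_sum fun i _ => h5 i).trans ?_
    rw [Finset.sum_add_distrib, ← Finset.sum_mul, hq1, one_mul, ← Finset.sum_filter]
    linarith
  have h6 := abs_lt.1 hK2
  have h7 := abs_lt.1 h2
  have h8 := abs_le.1 h4
  rw [abs_lt]
  constructor <;> linarith

/-- A quadratic exponential tilt of the standard Gaussian is a multiple of a Gaussian. -/
lemma integral_gaussian_tilt {κ : ℝ} (hκ : 0 < κ) (h : ℝ → ℝ) :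
    ∫ u, h u * Real.exp ((1 - κ) / 2 * u ^ 2) ∂(ProbabilityTheory.gaussianReal 0 1) =
      (√κ)⁻¹ * ∫ u, h u ∂(ProbabilityTheory.gaussianReal 0 (κ⁻¹).toNNReal) := by
  have hκ' : (κ⁻¹).toNNReal ≠ 0 := (Real.toNNReal_pos.2 (inv_pos.2 hκ)).ne'
  rw [ProbabilityTheory.integral_gaussianReal_eq_integral_smul one_ne_zero,
    ProbabilityTheory.integral_gaussianReal_eq_integral_smul hκ', ← integral_const_mul]
  congr 1
  ext u
  simp only [ProbabilityTheory.gaussianPDFReal, smul_eq_mul, NNReal.coe_one, mul_one, sub_zero,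
    Real.coe_toNNReal _ (inv_pos.2 hκ).le]
  rw [Real.sqrt_mul (by positivity) κ⁻¹, Real.sqrt_inv]
  have h1 : Real.exp (-u ^ 2 / (2 * κ⁻¹)) =
      Real.exp (-u ^ 2 / 2) * Real.exp ((1 - κ) / 2 * u ^ 2) := by
    rw [← Real.exp_add]
    congr 1
    field_simp
    ring
  have h2 : √κ ≠ 0 := (Real.sqrt_pos.2 hκ).ne'
  rw [h1]
  field_simp

lemma integrable_gaussian_tilt {κ : ℝ} (hκ : 0 < κ) :
    Integrable (fun u => Real.exp ((1 - κ) / 2 * u ^ 2)) (ProbabilityTheory.gaussianReal 0 1) := by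
  rw [ProbabilityTheory.gaussianReal_of_var_ne_zero 0 one_ne_zero,
    integrable_withDensity_iff_integrable_smul₀' (by fun_prop)
      (Eventually.of_forall fun _ => ProbabilityTheory.gaussianPDF_lt_top)]
  have : Integrable (fun u : ℝ => (√(2 * π))⁻¹ * Real.exp (-(κ / 2) * u ^ 2)) :=
    (integrable_exp_neg_mul_sq (half_pos hκ)).const_mul _
  refine this.congr (Eventually.of_forall fun u => ?_)
  simp only [ProbabilityTheory.toReal_gaussianPDF, ProbabilityTheory.gaussianPDFReal, smul_eq_mul,
    NNReal.coe_one, mul_one, sub_zero]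
  rw [mul_assoc, ← Real.exp_add]
  ring_nf

lemma gaussCDF_eq {v : ℝ} (hv : 0 < v) (x : ℝ) :
    gaussCDF v x = (ProbabilityTheory.gaussianReal 0 v.toNNReal).real (Set.Iic x) := by
  rw [measureReal_def, ProbabilityTheory.gaussianReal_apply_eq_integral _
    (Real.toNNReal_pos.2 hv).ne', ENNReal.toReal_ofReal
    (integral_nonneg fun u => ProbabilityTheory.gaussianPDFReal_nonneg _ _ _)]
  simp [gaussCDF, gaussProb, ProbabilityTheory.gaussianPDFReal, hv.le]

/-- The expectation over the configurations with magnetization close to the maximizer. -/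
lemma exists_tendsto_near {p : ℕ} (hp : 3 ≤ p) {β m : ℝ} (hβ : betaStar p < β) (hm : 0 < m)
    (hmax : isMaximizer p β 0 m) :
    ∃ δ > 0, √(1 - m ^ 2) * δ < m ∧ ∀ f : BoundedContinuousFunction ℝ ℝ,
      Tendsto (fun N : ℕ => ∑ σ : Fin N → Bool, prodWeight m σ *
          if |stdMag m σ| ≤ δ * √N then
            f (√N * (gMPL p (mag σ / N) - β)) * Real.exp (N * tiltFun p β m (mag σ / N)) else 0)
        atTop (𝓝 (∫ u, f (slopeNum p m / (p * m ^ p) * √(1 - m ^ 2) * u) *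
          Real.exp ((1 - slopeNum p m / m * (1 - m ^ 2)) / 2 * u ^ 2)
          ∂(ProbabilityTheory.gaussianReal 0 1))) := by
  have h1 := hmax.1.1
  have h2 := hmax.1.2
  have hv : 0 < 1 - m ^ 2 := by nlinarith
  have hsl := slopeNum_maximizer_pos hp hβ hm hmax
  set τ := √(1 - m ^ 2) with hτdef
  have hτ : 0 < τ := Real.sqrt_pos.2 hv
  have hτ2 : τ ^ 2 = 1 - m ^ 2 := Real.sq_sqrt hv.le
  set κ := slopeNum p m / m * (1 - m ^ 2) with hκdef
  have hκ : 0 < κ := by positivity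
  obtain ⟨R, hRc, hRm, hR⟩ := exists_tiltFun_eq hmax
  rw [iteratedDeriv_two_Hfun_maximizer hp hm hmax] at hRm
  have hRm' : τ ^ 2 * R m = (1 - κ) / 2 := by
    rw [hRm, hκdef, hτ2]
    field_simp
    ring
  obtain ⟨a₁, ha₁, ha₁'⟩ := exists_between (show max 0 (1 - κ) < 1 from max_lt one_pos (by linarith))
  obtain ⟨a, ha, ha'⟩ := exists_between ha₁'
  have ha₁0 : 0 < a₁ := (le_max_left _ _).trans_lt ha₁
  have ha₁κ : 1 - κ < a₁ := (le_max_right _ _).trans_lt ha₁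
  obtain ⟨δ₀, hδ₀, M, hM⟩ := exists_gaussian_moment_bound h1 h2 (ha₁0.trans ha) ha'
  have hlt : τ ^ 2 * R m < a₁ / 2 := by rw [hRm']; linarith
  obtain ⟨r, hr, hball⟩ := Metric.eventually_nhds_iff.1
    ((hRc.const_mul (τ ^ 2)).eventually_lt_const hlt)
  obtain ⟨δ, hδ, hδ'⟩ := exists_between (show 0 < min δ₀ (min (r / τ) (m / τ)) by positivity)
  rw [lt_min_iff, lt_min_iff, lt_div_iff₀ hτ, lt_div_iff₀ hτ] at hδ'
  obtain ⟨hδ1, hδ2, hδ3⟩ := hδ'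
  refine ⟨δ, hδ, by linarith, fun f => ?_⟩
  set T : ℕ → ℝ → ℝ := fun N u => m + τ * u / √N with hT
  set F : ℕ → ℝ → ℝ := fun N u => if |u| ≤ δ * √N then
    f (√N * (gMPL p (T N u) - β)) * Real.exp (N * tiltFun p β m (T N u)) else 0 with hF
  have htilt : ∀ (N : ℕ) (u : ℝ), 0 < N → N * tiltFun p β m (T N u) = τ ^ 2 * R (T N u) * u ^ 2 := by
    intro N u hN
    have hN' : (0 : ℝ) < N := by positivity
    rw [hR, hT]
    have : (√(N : ℝ)) ^ 2 = N := Real.sq_sqrt hN'.le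
    rw [add_sub_cancel_left, div_pow, this]
    field_simp
  have hbound : ∀ (N : ℕ) (u : ℝ), 0 < N → |F N u| ≤
      if |u| ≤ δ * √N then ‖f‖ * Real.exp (a₁ / 2 * u ^ 2) else 0 := by
    intro N u hN
    have hn : 0 < √(N : ℝ) := Real.sqrt_pos.2 (by positivity)
    simp only [hF]
    split_ifs with h
    · rw [abs_mul, Real.abs_exp, htilt N u hN]
      refine mul_le_mul (f.norm_coe_le_norm _) (Real.exp_le_exp.2 ?_) (Real.exp_pos _).le
        (norm_nonneg _)
      refine mul_le_mul_of_nonneg_right (hball ?_).le (sq_nonneg u)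
      rw [Real.dist_eq, hT, add_sub_cancel_left, abs_div, abs_mul, abs_of_pos hτ, abs_of_pos hn,
        div_lt_iff₀ hn]
      nlinarith
    · simp
  have hsqrt : Tendsto (fun N : ℕ => √(N : ℝ)) atTop atTop :=
    Real.tendsto_sqrt_atTop.comp tendsto_natCast_atTop_atTop
  have key := tendsto_sum_of_tendsto_prod (ι := fun N => Fin N → Bool)
    (q := fun N σ => prodWeight m σ) (U := fun N σ => stdMag m σ)
    (γ := ProbabilityTheory.gaussianReal 0 1)
    (fun N => prodWeight_nonneg h1.le h2.le) (fun N => sum_prodWeight N m)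
    (tendsto_stdMag h1 h2) (F := F)
    (G := fun u => f (slopeNum p m / (p * m ^ p) * τ * u) * Real.exp ((1 - κ) / 2 * u ^ 2))
    (by fun_prop)
    ((integrable_gaussian_tilt hκ).bdd_mul (c := ‖f‖)
      (f.continuous.comp (continuous_const.mul continuous_id)).aestronglyMeasurable
      (Eventually.of_forall fun u => f.norm_coe_le_norm _)) ?_ ?_
  · refine key.congr' ?_
    filter_upwards [eventually_gt_atTop 0] with N hN
    refine Finset.sum_congr rfl fun σ _ => ?_
    rw [mag_div_eq hN h1 h2]
  · intro u
    have hn : Tendsto (fun z : ℕ × ℝ => √(z.1 : ℝ)) (atTop ×ˢ 𝓝 u) atTop := hsqrt.comp tendsto_fst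
    have hz : Tendsto (fun z : ℕ × ℝ => z.2) (atTop ×ˢ 𝓝 u) (𝓝 u) := tendsto_snd
    have hTm : Tendsto (fun z : ℕ × ℝ => T z.1 z.2) (atTop ×ˢ 𝓝 u) (𝓝 m) := by
      simpa using ((hz.const_mul τ).div_atTop hn).const_add m
    have hg : Tendsto (fun z : ℕ × ℝ => dslope (gMPL p) m (T z.1 z.2) * τ * z.2)
        (atTop ×ˢ 𝓝 u) (𝓝 (slopeNum p m / (p * m ^ p) * τ * u)) := by
      have hd := hasDerivAt_gMPL hp hm h2
      have := (continuousAt_dslope_same.2 hd.differentiableAt).tendsto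
      rw [dslope_same, hd.deriv] at this
      exact ((this.comp hTm).mul_const τ).mul hz
    have hR' : Tendsto (fun z : ℕ × ℝ => τ ^ 2 * R (T z.1 z.2) * z.2 ^ 2)
        (atTop ×ˢ 𝓝 u) (𝓝 ((1 - κ) / 2 * u ^ 2)) := by
      rw [← hRm']
      exact ((hRc.tendsto.comp hTm).const_mul _).mul (hz.pow 2)
    refine (((f.continuous.tendsto _).comp hg).mul ((Real.continuous_exp.tendsto _).comp hR')).congr' ?_
    have hpos : ∀ᶠ z : ℕ × ℝ in atTop ×ˢ 𝓝 u, 0 < z.1 :=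
      tendsto_fst.eventually (eventually_gt_atTop 0)
    have hu1 : ∀ᶠ z : ℕ × ℝ in atTop ×ˢ 𝓝 u, |z.2| < |u| + 1 :=
      hz.abs.eventually_lt_const (by linarith)
    filter_upwards [hpos, hu1, (hn.const_mul_atTop hδ).eventually_ge_atTop (|u| + 1)]
      with z hz1 hz2 hz3
    have hn' : 0 < √(z.1 : ℝ) := Real.sqrt_pos.2 (by positivity)
    simp only [Function.comp_apply, hF]
    rw [if_pos (hz2.le.trans hz3), htilt _ _ hz1]
    congr 2
    have := sub_smul_dslope (gMPL p) m (T z.1 z.2)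
    rw [gMPL_maximizer hp hm hmax] at this
    rw [← this, hT, smul_eq_mul, add_sub_cancel_left]
    field_simp
  · intro ε hε
    have hK : Tendsto (fun K : ℕ => ‖f‖ * Real.exp (-((a - a₁) / 2 * (K : ℝ) ^ 2)) * M) atTop
        (𝓝 0) := by
      have : Tendsto (fun K : ℕ => (a - a₁) / 2 * (K : ℝ) ^ 2) atTop atTop :=
        ((tendsto_pow_atTop two_ne_zero).comp tendsto_natCast_atTop_atTop).const_mul_atTop
          (by linarith)
      simpa using ((Real.tendsto_exp_neg_atTop_nhds_zero.comp this).const_mul ‖f‖).mul_const M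
    filter_upwards [hK.eventually_le_const hε] with K hK
    filter_upwards [hM, eventually_gt_atTop 0] with N hN hN0
    refine le_trans ?_ hK
    refine le_trans ?_ (mul_le_mul_of_nonneg_left hN (by positivity))
    rw [Finset.mul_sum, Finset.sum_filter, Finset.sum_filter]
    refine Finset.sum_le_sum fun σ _ => ?_
    have hq := prodWeight_nonneg h1.le h2.le σ
    have hb := hbound N (stdMag m σ) hN0
    by_cases hδN : |stdMag m σ| ≤ δ * √N
    · rw [if_pos hδN] at hb
      rw [if_pos (hδN.trans (by gcongr))]
      split_ifs with hKU
      · calc prodWeight m σ * |F N (stdMag m σ)|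
            ≤ prodWeight m σ * (‖f‖ * Real.exp (a₁ / 2 * stdMag m σ ^ 2)) := by gcongr
          _ ≤ prodWeight m σ * (‖f‖ * Real.exp (-((a - a₁) / 2 * (K : ℝ) ^ 2) +
                a / 2 * stdMag m σ ^ 2)) := by
              gcongr
              have : (K : ℝ) ^ 2 ≤ stdMag m σ ^ 2 := by
                rw [← sq_abs (stdMag m σ)]; gcongr
              nlinarith
          _ = _ := by rw [Real.exp_add]; ring
      · positivity
    · rw [if_neg hδN] at hb
      rw [le_antisymm hb (abs_nonneg _), mul_zero, ite_self]
      split_ifs <;> positivity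

lemma mag_not {N : ℕ} (σ : Fin N → Bool) : mag (fun i => !σ i) = -mag σ := by
  simp [mag, spin_not]

lemma cwWeight_not {p N : ℕ} (hN : 0 < N) (he : Even p) (β : ℝ) (σ : Fin N → Bool) :
    cwWeight p N β 0 (fun i => !σ i) = cwWeight p N β 0 σ := by
  rw [cwWeight_eq hN, cwWeight_eq hN, mag_not, neg_div, he.neg_pow]

/-- Up to an exponentially small error, the partition function restricted to a neighbourhood of the
positive maximizer gives the whole one, twice over when `p` is even. -/
lemma exists_abs_sum_sub_near_le {p : ℕ} (hp : 3 ≤ p) {β m : ℝ} (hβ : betaStar p < β) (hm : 0 < m)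
    (hmax : isMaximizer p β 0 m) (huniq : ∀ m', 0 < m' → isMaximizer p β 0 m' → m' = m)
    {η : ℝ} (hη : 0 < η) (hηm : η < m) :
    ∃ c > 0, ∀ N : ℕ, 0 < N → ∀ (φ : ℝ → ℝ) (B : ℝ), (∀ t, |φ t| ≤ B) →
      (Even p → ∀ t, φ (-t) = φ t) →
      |∑ σ : Fin N → Bool, cwWeight p N β 0 σ * φ (mag σ / N) -
        (if Even p then 2 else 1) * ∑ σ : Fin N → Bool with |mag σ / N - m| ≤ η,
          cwWeight p N β 0 σ * φ (mag σ / N)| ≤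
        B * ((N + 1) * Real.exp (N * (Hfun p β 0 m - c + Real.log 2))) := by
  obtain ⟨c, hc, hgap⟩ := exists_gap hp hβ hm hmax huniq hη
  refine ⟨c, hc, fun N hN φ B hB hφ => ?_⟩
  have hB0 : 0 ≤ B := (abs_nonneg _).trans (hB 0)
  have hw : ∀ σ : Fin N → Bool, 0 ≤ cwWeight p N β 0 σ := fun σ => (Real.exp_pos _).le
  have hrest := sum_cwWeight_le (p := p) hN β (Hfun p β 0 m - c)
    (Finset.univ.filter fun σ : Fin N → Bool => ¬ |mag σ / N - m| ≤ η ∧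
      (Even p → ¬ |mag σ / N + m| ≤ η)) fun σ hσ => by
        rw [Finset.mem_filter] at hσ
        exact hgap _ (mag_div_mem σ) (not_le.1 hσ.2.1).le fun he => (not_le.1 (hσ.2.2 he)).le
  have hsplit : ∑ σ : Fin N → Bool, cwWeight p N β 0 σ * φ (mag σ / N) -
        (if Even p then 2 else 1) * ∑ σ : Fin N → Bool with |mag σ / N - m| ≤ η,
          cwWeight p N β 0 σ * φ (mag σ / N) =
      ∑ σ : Fin N → Bool with ¬ |mag σ / N - m| ≤ η ∧ (Even p → ¬ |mag σ / N + m| ≤ η),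
        cwWeight p N β 0 σ * φ (mag σ / N) := by
    by_cases he : Even p
    · have hflip : ∑ σ : Fin N → Bool with |mag σ / N - m| ≤ η,
          cwWeight p N β 0 σ * φ (mag σ / N) =
          ∑ σ : Fin N → Bool with |mag σ / N + m| ≤ η, cwWeight p N β 0 σ * φ (mag σ / N) := by
        refine Finset.sum_nbij' (fun σ i => !σ i) (fun σ i => !σ i) (fun σ hσ => ?_)
          (fun σ hσ => ?_) (fun σ _ => by simp) (fun σ _ => by simp) (fun σ _ => ?_)
        · simp only [Finset.mem_filter, Finset.mem_univ, true_and, mag_not] at hσ ⊢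
          rwa [← abs_neg, neg_div, neg_add, neg_neg, ← sub_eq_add_neg]
        · simp only [Finset.mem_filter, Finset.mem_univ, true_and, mag_not] at hσ ⊢
          rwa [← abs_neg, neg_div, neg_sub, sub_neg_eq_add, add_comm]
        · rw [cwWeight_not hN he, mag_not, neg_div, hφ he]
      rw [if_pos he, two_mul]
      nth_rewrite 2 [hflip]
      simp only [Finset.sum_filter]
      rw [← Finset.sum_add_distrib, ← Finset.sum_sub_distrib]
      refine Finset.sum_congr rfl fun σ _ => ?_
      by_cases h3 : |mag σ / N - m| ≤ η <;> by_cases h4 : |mag σ / N + m| ≤ η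
      · exact absurd (abs_le.1 h4).2 (by linarith [(abs_le.1 h3).1])
      all_goals simp [h3, h4, he]
    · rw [if_neg he, one_mul, ← Finset.sum_filter_add_sum_filter_not Finset.univ
        (fun σ : Fin N → Bool => |mag σ / N - m| ≤ η), add_sub_cancel_left]
      simp [he]
  rw [hsplit]
  refine (Finset.abs_sum_le_sum_abs _ _).trans ((Finset.sum_le_sum fun σ _ => ?_).trans
    ((Finset.mul_sum _ _ _).symm.le.trans (mul_le_mul_of_nonneg_left hrest hB0)))
  rw [abs_mul, abs_of_nonneg (hw σ), mul_comm]
  exact mul_le_mul_of_nonneg_right (hB _) (hw σ)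

/-- Convergence of the Gibbs expectations of bounded continuous functions of the rescaled maximum
pseudolikelihood estimate. -/
lemma tendsto_gibbs_expectation {p : ℕ} (hp : 3 ≤ p) {β m : ℝ} (hβ : betaStar p < β) (hm : 0 < m)
    (hmax : isMaximizer p β 0 m) (huniq : ∀ m', 0 < m' → isMaximizer p β 0 m' → m' = m)
    (f : BoundedContinuousFunction ℝ ℝ) :
    Tendsto (fun N : ℕ => ∑ σ : Fin N → Bool,
        cwWeight p N β 0 σ / (∑ x : Fin N → Bool, cwWeight p N β 0 x) *
          f (√N * (gMPL p (mag σ / N) - β))) atTop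
      (𝓝 (∫ y, f y ∂(ProbabilityTheory.gaussianReal 0
        (-(iteratedDeriv 2 (Hfun p β 0) m) / ((p : ℝ) ^ 2 * m ^ (2 * p - 2))).toNNReal))) := by
  have h1 := hmax.1.1
  have h2 := hmax.1.2
  have hv : 0 < 1 - m ^ 2 := by nlinarith
  have hsl := slopeNum_maximizer_pos hp hβ hm hmax
  obtain ⟨δ, hδ, hδm, hnear⟩ := exists_tendsto_near hp hβ hm hmax
  set τ := √(1 - m ^ 2) with hτdef
  have hτ : 0 < τ := Real.sqrt_pos.2 hv
  have hτ2 : τ ^ 2 = 1 - m ^ 2 := Real.sq_sqrt hv.le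
  set κ := slopeNum p m / m * (1 - m ^ 2) with hκdef
  have hκ : 0 < κ := by positivity
  set s := slopeNum p m / (p * m ^ p) with hs
  obtain ⟨c, hc, hfar⟩ := exists_abs_sum_sub_near_le hp hβ hm hmax huniq (mul_pos hτ hδ) hδm
  set k : ℝ := if Even p then 2 else 1 with hk
  have hk0 : 0 < k := by rw [hk]; split_ifs <;> norm_num
  have htotal : ∀ f : BoundedContinuousFunction ℝ ℝ,
      Tendsto (fun N : ℕ => Real.exp (-(N * (Hfun p β 0 m + Real.log 2))) *
        ∑ σ : Fin N → Bool, cwWeight p N β 0 σ * f (√N * (gMPL p (mag σ / N) - β))) atTop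
      (𝓝 (k * ∫ u, f (s * τ * u) * Real.exp ((1 - κ) / 2 * u ^ 2)
        ∂(ProbabilityTheory.gaussianReal 0 1))) := by
    intro f
    have herr : Tendsto (fun N : ℕ => ‖f‖ * ((N + 1) * Real.exp (-c * N))) atTop (𝓝 0) := by
      have h3 : Tendsto (fun N : ℕ => (N : ℝ) * Real.exp (-c * N)) atTop (𝓝 0) := by
        have := (tendsto_rpow_mul_exp_neg_mul_atTop_nhds_zero 1 c hc).comp
          tendsto_natCast_atTop_atTop
        simpa [Function.comp_def] using this
      have h4 : Tendsto (fun N : ℕ => Real.exp (-c * N)) atTop (𝓝 0) := by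
        have := (tendsto_rpow_mul_exp_neg_mul_atTop_nhds_zero 0 c hc).comp
          tendsto_natCast_atTop_atTop
        simpa [Function.comp_def] using this
      simpa [add_mul] using (h3.add h4).const_mul ‖f‖
    have hmain := (hnear f).const_mul k
    refine (tendsto_iff_of_dist (squeeze_zero' (Eventually.of_forall fun _ => dist_nonneg) ?_
      herr)).1 hmain
    filter_upwards [eventually_gt_atTop 0] with N hN
    have hn : 0 < √(N : ℝ) := Real.sqrt_pos.2 (by positivity)
    have hset : ∀ σ : Fin N → Bool, |mag σ / N - m| ≤ τ * δ ↔ |stdMag m σ| ≤ δ * √N := by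
      intro σ
      rw [mag_div_eq hN h1 h2, add_sub_cancel_left, abs_div, abs_mul, abs_of_pos hτ, abs_of_pos hn,
        div_le_iff₀ hn, mul_assoc, mul_le_mul_iff_right₀ hτ]
    have hb := hfar N hN (fun t => f (√N * (gMPL p t - β))) ‖f‖ (fun t => f.norm_coe_le_norm _)
      fun he t => by simp only [gMPL_neg_even hp he]
    have hsum : (∑ σ : Fin N → Bool, prodWeight m σ * if |stdMag m σ| ≤ δ * √N then
        f (√N * (gMPL p (mag σ / N) - β)) * Real.exp (N * tiltFun p β m (mag σ / N)) else 0) =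
        Real.exp (-(N * (Hfun p β 0 m + Real.log 2))) *
          ∑ σ : Fin N → Bool with |mag σ / N - m| ≤ τ * δ,
            cwWeight p N β 0 σ * f (√N * (gMPL p (mag σ / N) - β)) := by
      rw [Finset.sum_filter, Finset.mul_sum]
      refine Finset.sum_congr rfl fun σ _ => ?_
      simp only [hset]
      split_ifs
      · rw [cwWeight_eq_prodWeight hN β h1 h2, Real.exp_neg]
        field_simp
      · simp
    rw [hsum, dist_comm, Real.dist_eq, mul_left_comm, ← mul_sub, abs_mul, Real.abs_exp]
    refine (mul_le_mul_of_nonneg_left hb (Real.exp_pos _).le).trans_eq ?_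
    rw [show (N : ℝ) * (Hfun p β 0 m - c + Real.log 2) =
      N * (Hfun p β 0 m + Real.log 2) + -c * N by ring, Real.exp_add, Real.exp_neg]
    field_simp
  have hone := htotal (BoundedContinuousFunction.const ℝ 1)
  have hf := htotal f
  rw [integral_gaussian_tilt hκ fun u => f (s * τ * u)] at hf
  simp only [BoundedContinuousFunction.const_apply] at hone
  rw [integral_gaussian_tilt hκ fun _ => 1] at hone
  simp only [integral_const, probReal_univ, smul_eq_mul, mul_one] at hone
  have hκs : 0 < √κ := Real.sqrt_pos.2 hκ
  have hlim := hf.div hone (by positivity)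
  have hmap : ProbabilityTheory.gaussianReal 0
      (-(iteratedDeriv 2 (Hfun p β 0) m) / ((p : ℝ) ^ 2 * m ^ (2 * p - 2))).toNNReal =
      (ProbabilityTheory.gaussianReal 0 (κ⁻¹).toNNReal).map (fun u => s * τ * u) := by
    rw [ProbabilityTheory.gaussianReal_map_const_mul, mul_zero]
    congr 1
    rw [← NNReal.coe_inj, NNReal.coe_mul, Real.coe_toNNReal _ (inv_pos.2 hκ).le, NNReal.coe_mk,
      iteratedDeriv_two_Hfun_maximizer hp hm hmax, neg_neg, Real.coe_toNNReal _ (by positivity),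
      mul_pow, hτ2, hs, hκdef]
    have hpow : m ^ (2 * p - 2) * m ^ 2 = (m ^ p) ^ 2 := by
      rw [← pow_add, ← pow_mul]; congr 1; omega
    have hpow' : m ^ p ≠ 0 := by positivity
    field_simp
    rw [← hpow]
    ring
  rw [hmap, integral_map (by fun_prop) f.continuous.aestronglyMeasurable]
  have hval : ∀ I : ℝ, k * ((√κ)⁻¹ * I) / (k * (√κ)⁻¹) = I := fun I => by field_simp
  rw [hval] at hlim
  refine hlim.congr fun N => ?_
  rw [Pi.div_apply, mul_div_mul_left _ _ (Real.exp_pos _).ne', Finset.sum_div]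
  exact Finset.sum_congr rfl fun σ _ => by ring

/-- **CLT for the maximum pseudolikelihood estimate of `β`.** -/
theorem clt_mple
    (p : ℕ) (hp : 3 ≤ p) (β m : ℝ) (hβ : betaStar p < β)
    (hm : 0 < m) (hmax : isMaximizer p β 0 m)
    (huniq : ∀ m', 0 < m' → isMaximizer p β 0 m' → m' = m) :
    ∀ x : ℝ,
      Tendsto (fun N : ℕ =>
          cwProb p N β 0 {σ | Real.sqrt N * (gMPL p (mag σ / N) - β) ≤ x})
        atTop
        (𝓝 (gaussCDF
          (-(iteratedDeriv 2 (Hfun p β 0) m) / ((p : ℝ) ^ 2 * m ^ (2*p - 2))) x)) := by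
  intro x
  set v := -(iteratedDeriv 2 (Hfun p β 0) m) / ((p : ℝ) ^ 2 * m ^ (2 * p - 2)) with hv
  have hvpos : 0 < v := by
    have := slopeNum_maximizer_pos hp hβ hm hmax
    rw [hv, iteratedDeriv_two_Hfun_maximizer hp hm hmax, neg_neg]
    positivity
  have hZ : ∀ N, 0 < ∑ σ : Fin N → Bool, cwWeight p N β 0 σ := fun N =>
    Finset.sum_pos (fun _ _ => Real.exp_pos _) Finset.univ_nonempty
  have hw : ∀ (N : ℕ) (σ : Fin N → Bool),
      0 ≤ cwWeight p N β 0 σ / ∑ x : Fin N → Bool, cwWeight p N β 0 x :=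
    fun N σ => div_nonneg (Real.exp_pos _).le (hZ N).le
  have hprob : ∀ N : ℕ, IsProbabilityMeasure (finiteLaw
      (fun σ : Fin N → Bool => cwWeight p N β 0 σ / ∑ x : Fin N → Bool, cwWeight p N β 0 x)
      fun σ => √N * (gMPL p (mag σ / N) - β)) := fun N =>
    isProbabilityMeasure_finiteLaw _ (hw N) (by rw [← Finset.sum_div, div_self (hZ N).ne'])
  let μs : ℕ → ProbabilityMeasure ℝ := fun N => ⟨_, hprob N⟩
  let μ : ProbabilityMeasure ℝ := ⟨ProbabilityTheory.gaussianReal 0 v.toNNReal, inferInstance⟩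
  have hlim : Tendsto μs atTop (𝓝 μ) := by
    refine ProbabilityMeasure.tendsto_iff_forall_integral_tendsto.2 fun f => ?_
    refine (tendsto_gibbs_expectation hp hβ hm hmax huniq f).congr fun N => ?_
    exact (integral_finiteLaw _ (hw N) _).symm
  have hatom : NullSingletonClass (ProbabilityTheory.gaussianReal 0 v.toNNReal) :=
    ProbabilityTheory.nullSingletonClass_gaussianReal (Real.toNNReal_pos.2 hvpos).ne'
  have key := ProbabilityMeasure.tendsto_measure_of_null_frontier_of_tendsto' hlim
    (E := Set.Iic x) (by rw [frontier_Iic]; exact hatom.measure_singleton x)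
  rw [gaussCDF_eq hvpos]
  refine ((ENNReal.tendsto_toReal (measure_ne_top _ _)).comp key).congr fun N => ?_
  change (finiteLaw _ _).real (Set.Iic x) = _
  rw [← integral_indicator_one measurableSet_Iic, integral_finiteLaw _ (hw N), cwProb,
    Finset.sum_div]
  refine Finset.sum_congr rfl fun σ _ => ?_
  by_cases h : √N * (gMPL p (mag σ / N) - β) ≤ x <;> simp [Set.indicator, h]
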